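/- Let U ⊂ ℂ^n be a bounded domain and let a ∈ U. Then there exists r > 0 such that every automorphism f of U whose fixed point set is discrete in U has at most one fixed point in the Euclidean ball B(a, r). -/

import Mathlib

open Set Metric Filter Topology

noncomputable section

/-- `ℂ^n` with the Euclidean norm. -/
abbrev CSpace (n : ℕ) := EuclideanSpace ℂ (Fin n)

/-- `f` is an automorphism of the set `D`: a holomorphic bijection of `D` onto
itself with a holomorphic inverse. -/
def AutOn {n : ℕ} (D : Set (CSpace n)) (f : CSpace n → CSpace n) : Prop :=
  DifferentiableOn ℂ f D ∧ Set.BijOn f D D ∧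
  ∃ g : CSpace n → CSpace n, DifferentiableOn ℂ g D ∧ Set.BijOn g D D ∧
    (∀ z ∈ D, g (f z) = z) ∧ (∀ z ∈ D, f (g z) = z)

/-- The fixed point set of `f` in `D`. -/
def FixOn {n : ℕ} (D : Set (CSpace n)) (f : CSpace n → CSpace n) : Set (CSpace n) :=
  {z ∈ D | f z = z}

/-- Every point of `S` is isolated in `S`. -/
def DiscreteIn {n : ℕ} (S : Set (CSpace n)) : Prop :=
  ∀ z ∈ S, ∃ ε > 0, ∀ w ∈ S, w ≠ z → ε ≤ dist w z

/-- `f` extends holomorphically beyond the boundary of `D`. -/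
def ExtendsHolo {n : ℕ} (D : Set (CSpace n)) (f : CSpace n → CSpace n) : Prop :=
  ∃ U : Set (CSpace n), IsOpen U ∧ closure D ⊆ U ∧
    ∃ F : CSpace n → CSpace n, DifferentiableOn ℂ F U ∧ Set.EqOn F f D

/-- `H` is a compact subgroup of the automorphism group of `D`. -/
def IsCompactAutGroup {n : ℕ} (D : Set (CSpace n))
    (H : Set (CSpace n → CSpace n)) : Prop :=
  (∀ f ∈ H, AutOn D f) ∧
  (∃ e ∈ H, ∀ z ∈ D, e z = z) ∧
  (∀ f ∈ H, ∀ g ∈ H, ∃ h ∈ H, ∀ z ∈ D, h z = f (g z)) ∧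
  (∀ f ∈ H, ∃ g ∈ H, (∀ z ∈ D, g (f z) = z) ∧ (∀ z ∈ D, f (g z) = z)) ∧
  (∀ u : ℕ → (CSpace n → CSpace n), (∀ k, u k ∈ H) →
    ∃ φ : ℕ → ℕ, StrictMono φ ∧ ∃ f ∈ H, ∀ K : Set (CSpace n), K ⊆ D → IsCompact K →
      TendstoUniformlyOn (fun k => u (φ k)) f Filter.atTop K)

section CauchyEstimates

variable {E F : Type*} [NormedAddCommGroup E] [NormedSpace ℂ E]
  [NormedAddCommGroup F] [NormedSpace ℂ F]

theorem norm_fderiv_le_of_norm_le {f : E → F} {c : E} {R M : ℝ} (hR : 0 < R)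
    (hf : DifferentiableOn ℂ f (ball c R)) (hM : ∀ x ∈ ball c R, ‖f x‖ ≤ M) :
    ‖fderiv ℂ f c‖ ≤ 2 * M / R := by
  refine Complex.norm_fderiv_le_div_of_mapsTo_ball hf (fun x hx => ?_) hR
  rw [mem_closedBall, dist_eq_norm]
  linarith [norm_sub_le (f x) (f c), hM x hx, hM c (mem_ball_self hR)]

theorem norm_fderiv_sub_fderiv_le_of_norm_le {f : E → F} {c : E} {R M : ℝ} (hR : 0 < R)
    (hf : DifferentiableOn ℂ f (ball c (3 * R))) (hM : ∀ x ∈ ball c (3 * R), ‖f x‖ ≤ M)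
    {x : E} (hx : x ∈ ball c R) :
    ‖fderiv ℂ f x - fderiv ℂ f c‖ ≤ 4 * M / R ^ 2 * ‖x - c‖ := by
  have hdiff : ∀ y ∈ ball c (3 * R), DifferentiableAt ℂ f y := fun y hy =>
    hf.differentiableAt (isOpen_ball.mem_nhds hy)
  have hbound : ∀ y ∈ ball c (2 * R), ‖fderiv ℂ f y‖ ≤ 2 * M / R := fun y hy => by
    have hsub : ball y R ⊆ ball c (3 * R) := by
      refine ball_subset_ball' ?_
      linarith [mem_ball.1 hy]
    exact norm_fderiv_le_of_norm_le hR (hf.mono hsub) fun p hp => hM p (hsub hp)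
  have hx' : ‖x - c‖ < R := by simpa [dist_eq_norm] using hx
  have hshift : ∀ p ∈ ball c R, p + (x - c) ∈ ball c (2 * R) := fun p hp => by
    rw [mem_ball, dist_eq_norm] at *
    calc ‖p + (x - c) - c‖ = ‖(p - c) + (x - c)‖ := by congr 1; abel
      _ ≤ ‖p - c‖ + ‖x - c‖ := norm_add_le _ _
      _ < 2 * R := by linarith
  have h23 : ball c (2 * R) ⊆ ball c (3 * R) := ball_subset_ball (by linarith)
  have h12 : ball c R ⊆ ball c (2 * R) := ball_subset_ball (by linarith)
  have hderiv : ∀ p ∈ ball c R, HasFDerivAt (fun p => f (p + (x - c)) - f p)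
      (fderiv ℂ f (p + (x - c)) - fderiv ℂ f p) p := fun p hp =>
    ((hasFDerivAt_comp_add_right (x - c)).2 (hdiff _ (h23 (hshift p hp))).hasFDerivAt).sub
      (hdiff _ (h23 (h12 hp))).hasFDerivAt
  have key := norm_fderiv_le_of_norm_le (f := fun p => f (p + (x - c)) - f p)
    (M := 2 * M / R * ‖x - c‖) hR
    (fun p hp => (hderiv p hp).differentiableAt.differentiableWithinAt) fun p hp => by
      simpa using (convex_ball c (2 * R)).norm_image_sub_le_of_norm_fderiv_le (𝕜 := ℂ)
        (fun y hy => hdiff y (h23 hy)) hbound (h12 hp) (hshift p hp)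
  rw [(hderiv c (mem_ball_self hR)).fderiv, add_sub_cancel] at key
  calc _ ≤ _ := key
    _ = _ := by field_simp; ring

theorem approximatesLinearOn_of_norm_le {f : E → F} {f' : E →L[ℂ] F} {c : E} {R M δ : ℝ}
    {ε : NNReal} (hR : 0 < R)
    (hf : DifferentiableOn ℂ f (ball c (3 * R))) (hM : ∀ x ∈ ball c (3 * R), ‖f x‖ ≤ M)
    (hf' : HasFDerivAt f f' c) (hδR : δ ≤ R) (hδ : 4 * M / R ^ 2 * δ ≤ ε) :
    ApproximatesLinearOn f f' (ball c δ) ε := by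
  have hM0 : 0 ≤ M := (norm_nonneg _).trans (hM c (mem_ball_self (by linarith)))
  intro x hx y hy
  refine (convex_ball c δ).norm_image_sub_le_of_norm_fderiv_le' (𝕜 := ℂ)
    (fun p hp => hf.differentiableAt (isOpen_ball.mem_nhds
      (ball_subset_ball (by linarith) hp))) (fun p hp => ?_) hy hx
  rw [← hf'.fderiv]
  refine (norm_fderiv_sub_fderiv_le_of_norm_le hR hf hM (ball_subset_ball hδR hp)).trans
    (le_trans ?_ hδ)
  have : ‖p - c‖ ≤ δ := by simpa [dist_eq_norm] using (mem_ball.1 hp).le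
  gcongr

end CauchyEstimates

/-- An ultrafilter limit of the Cesàro means of `ψ k` intertwines `f` with the linear map `A`. -/
theorem exists_intertwining_approximatesLinearOn {E : Type*} [NormedAddCommGroup E]
    [NormedSpace ℂ E] [ProperSpace E] {U s : Set E} {f : E → E} {A L : E →L[ℂ] E}
    {ψ : ℕ → E → E} {C : ℝ} {ε : NNReal} (hf : MapsTo f U U)
    (hC : ∀ k, ∀ x ∈ U, ‖ψ k x‖ ≤ C) (hψ : ∀ k, ∀ x ∈ U, ψ k (f x) = A (ψ (k + 1) x))
    (hs : s ⊆ U) (hL : ∀ k, ApproximatesLinearOn (ψ k) L s ε) :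
    ∃ φ : E → E, (∀ x ∈ U, φ (f x) = A (φ x)) ∧ ApproximatesLinearOn φ L s ε := by
  let avg : ℕ → E → E := fun N x => ((N + 1 : ℕ) : ℂ)⁻¹ • ∑ k ∈ Finset.range (N + 1), ψ k x
  have norm_mean_le : ∀ (N : ℕ) (u : ℕ → E) (K : ℝ), (∀ k, ‖u k‖ ≤ K) →
      ‖((N + 1 : ℕ) : ℂ)⁻¹ • ∑ k ∈ Finset.range (N + 1), u k‖ ≤ K := by
    intro N u K hu
    have h : ‖∑ k ∈ Finset.range (N + 1), u k‖ ≤ ((N + 1 : ℕ) : ℝ) * K := by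
      simpa using norm_sum_le_of_le (Finset.range (N + 1)) fun k _ => hu k
    rw [norm_smul, norm_inv, Complex.norm_natCast, inv_mul_le_iff₀ (by positivity)]
    exact h
  have hlim : ∀ x ∈ U, ∃ y, Tendsto (fun N => avg N x) (hyperfilter ℕ) (𝓝 y) := by
    intro x hx
    obtain ⟨y, -, hy⟩ := (isCompact_closedBall (0 : E) C).ultrafilter_le_nhds
      ((hyperfilter ℕ).map fun N => avg N x) (by
        rw [le_principal_iff]
        refine Filter.Eventually.of_forall (f := (hyperfilter ℕ : Filter ℕ)) fun N => ?_
        simpa [avg] using norm_mean_le N (fun k => ψ k x) C fun k => hC k x hx)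
    exact ⟨y, hy⟩
  choose! φ hφ using hlim
  refine ⟨φ, fun x hx => ?_, fun x hx y hy => ?_⟩
  · have hdiff : ∀ N, avg N (f x) - A (avg N x)
        = ((N + 1 : ℕ) : ℂ)⁻¹ • A (ψ (N + 1) x - ψ 0 x) := by
      intro N
      simp only [avg, map_smul, ← smul_sub, hψ _ x hx, ← map_sum, ← map_sub]
      rw [← Finset.sum_sub_distrib, Finset.sum_range_sub (fun k => ψ k x)]
    have hzero : Tendsto (fun N => avg N (f x) - A (avg N x)) atTop (𝓝 0) := by
      have hN : Tendsto (fun N : ℕ => (1 / ((N : ℝ) + 1)) * (‖A‖ * (C + C))) atTop (𝓝 0) := by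
        simpa using tendsto_one_div_add_atTop_nhds_zero_nat.mul_const (‖A‖ * (C + C))
      refine squeeze_zero_norm (fun N => ?_) hN
      rw [hdiff, norm_smul, norm_inv, Complex.norm_natCast, one_div, Nat.cast_succ]
      gcongr
      exact A.le_opNorm_of_le ((norm_sub_le _ _).trans (add_le_add (hC _ x hx) (hC _ x hx)))
    have hsub := (hφ _ (hf hx)).sub ((A.continuous.tendsto _).comp (hφ x hx))
    exact sub_eq_zero.1
      (tendsto_nhds_unique hsub (hzero.mono_left Nat.hyperfilter_le_atTop))
  · have ht := (((hφ x (hs hx)).sub (hφ y (hs hy))).sub_const (L (x - y))).norm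
    refine le_of_tendsto ht (Filter.Eventually.of_forall fun N => ?_)
    have heq : avg N x - avg N y - L (x - y) = ((N + 1 : ℕ) : ℂ)⁻¹ •
        ∑ k ∈ Finset.range (N + 1), (ψ k x - ψ k y - L (x - y)) := by
      simp only [avg, Finset.sum_sub_distrib, smul_sub, Finset.sum_const, Finset.card_range]
      rw [← Nat.cast_smul_eq_nsmul ℂ, inv_smul_smul₀ (Nat.cast_ne_zero.2 N.succ_ne_zero)]
    rw [heq]
    exact norm_mean_le N _ _ fun k => hL k x hx y hy

/-- A linear map with two fixed vectors fixes the line through them, so a map conjugate to it has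
no isolated fixed point near another fixed point. -/
theorem eq_of_isolated_fixedPoint_of_intertwining {E : Type*} [NormedAddCommGroup E]
    [NormedSpace ℂ E] [CompleteSpace E] {f φ : E → E} {A : E →L[ℂ] E} {z w : E} {δ : ℝ}
    (hδ : 0 < δ) (hcont : ContinuousAt f z) (hz : f z = z) (hw : f w = w) (hwδ : w ∈ ball z δ)
    (hφ : ∀ x ∈ ball z δ, φ (f x) = A (φ x))
    (hL : ApproximatesLinearOn φ (ContinuousLinearMap.id ℂ E) (ball z δ) (1 / 2))
    (hiso : ∀ᶠ x in 𝓝 z, f x = x → x = z) : w = z := by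
  have hzδ : z ∈ ball z δ := mem_ball_self hδ
  have hinj : InjOn φ (ball z δ) := by
    intro x hx y hy hxy
    have h := hL x hx y hy
    rw [hxy, sub_self, zero_sub, norm_neg] at h
    simp only [ContinuousLinearMap.id_apply] at h
    have h2 : ((1 / 2 : NNReal) : ℝ) = 1 / 2 := by norm_num
    rw [h2] at h
    exact sub_eq_zero.1 (norm_le_zero_iff.1 (by linarith [norm_nonneg (x - y)]))
  have hAz : A (φ z) = φ z := by rw [← hφ z hzδ, hz]
  have hAw : A (φ w) = φ w := by rw [← hφ w hwδ, hw]
  let S : Set E := {x | x ∈ ball z δ ∧ f x ∈ ball z δ ∧ (f x = x → x = z)}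
  have hS : S ∈ 𝓝 z := by
    filter_upwards [ball_mem_nhds z hδ,
      hcont.preimage_mem_nhds (by rw [hz]; exact ball_mem_nhds z hδ), hiso] with x h1 h2 h3
    exact ⟨h1, h2, h3⟩
  have himage : φ '' S ∈ 𝓝 (φ z) := by
    have hLS := hL.mono_set (show S ⊆ ball z δ from fun x hx => hx.1)
    let idInv : (ContinuousLinearMap.id ℂ E).NonlinearRightInverse :=
      ⟨id, 1, fun y => by simp, fun y => rfl⟩
    refine hLS.image_mem_nhds idInv hS (.inr ?_)
    simpa [idInv] using NNReal.half_lt_self (one_ne_zero (α := NNReal))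
  have hline : Tendsto (fun t : ℝ => φ z + (t : ℂ) • (φ w - φ z)) (𝓝[>] 0) (𝓝 (φ z)) := by
    have : Continuous fun t : ℝ => φ z + (t : ℂ) • (φ w - φ z) := by fun_prop
    simpa using (this.tendsto 0).mono_left nhdsWithin_le_nhds
  obtain ⟨t, ⟨x, ⟨hxδ, hfx, hxz⟩, hxt⟩, ht⟩ :=
    ((hline.eventually himage).and self_mem_nhdsWithin).exists
  have hfix : f x = x := by
    refine hinj hfx hxδ ?_
    rw [hφ x hxδ, hxt]
    simp [hAz, hAw]
  rw [hxz hfix, left_eq_add, smul_eq_zero, sub_eq_zero] at hxt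
  rcases hxt with h | h
  · exact absurd (Complex.ofReal_eq_zero.1 h) (ne_of_gt ht)
  · exact hinj hwδ hzδ h

theorem at_most_one_fixed_point_in_small_ball {n : ℕ} (U : Set (CSpace n))
    (hUopen : IsOpen U) (hUconn : IsConnected U) (hUbdd : Bornology.IsBounded U)
    (a : CSpace n) (ha : a ∈ U) :
    ∃ r : ℝ, 0 < r ∧ ∀ f : CSpace n → CSpace n, AutOn U f → DiscreteIn (FixOn U f) →
      ∀ z ∈ FixOn U f ∩ Metric.ball a r, ∀ w ∈ FixOn U f ∩ Metric.ball a r, z = w := by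
  obtain ⟨ρ, hρ, hρU⟩ := Metric.isOpen_iff.1 hUopen a ha
  obtain ⟨M, hM0, hM⟩ := hUbdd.exists_pos_norm_le
  let R := ρ / 4
  have hR : 0 < R := by positivity
  let C := 2 * M / (3 * R) * M
  have hC : 0 < C := by positivity
  let δ := min R (R ^ 2 / (8 * C))
  have hδ : 0 < δ := by positivity
  have hδR : δ ≤ R := min_le_left _ _
  have hδC : 4 * C / R ^ 2 * δ ≤ ((1 / 2 : NNReal) : ℝ) := by
    calc 4 * C / R ^ 2 * δ ≤ 4 * C / R ^ 2 * (R ^ 2 / (8 * C)) := by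
          gcongr; exact min_le_right _ _
      _ = ((1 / 2 : NNReal) : ℝ) := by push_cast; field_simp; norm_num
  refine ⟨δ / 2, by positivity, ?_⟩
  rintro f ⟨hfd, hfb, g, hgd, hgb, hgf, hfg⟩ hdisc z ⟨⟨hzU, hz⟩, hza⟩ w ⟨⟨hwU, hw⟩, hwa⟩
  have hball : ball z (3 * R) ⊆ U := by
    refine (ball_subset_ball' ?_).trans hρU
    have := mem_ball.1 hza
    have : ρ = 4 * R := by simp only [R]; ring
    linarith
  have hwz : w ∈ ball z δ := by
    rw [mem_ball] at *
    linarith [dist_triangle_right w z a]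
  have hgz : g z = z := by simpa [hz] using hgf z hzU
  have hUz : U ∈ 𝓝 z := hUopen.mem_nhds hzU
  have hfz := (hfd.differentiableAt hUz).hasFDerivAt
  have hgz' := (hgd.differentiableAt hUz).hasFDerivAt
  set A := fderiv ℂ f z
  set B := fderiv ℂ g z
  have hAB : A * B = 1 := by
    have h1 : HasFDerivAt (fun x => f (g x)) (A.comp B) z :=
      HasFDerivAt.comp z (by rwa [hgz]) hgz'
    have h2 : HasFDerivAt (fun x => f (g x)) (ContinuousLinearMap.id ℂ _) z :=
      (hasFDerivAt_id z).congr_of_eventuallyEq (by filter_upwards [hUz] using hfg)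
    exact h1.unique h2
  have hBA : B * A = 1 := by
    have h1 : HasFDerivAt (fun x => g (f x)) (B.comp A) z :=
      HasFDerivAt.comp z (by rwa [hz]) hfz
    have h2 : HasFDerivAt (fun x => g (f x)) (ContinuousLinearMap.id ℂ _) z :=
      (hasFDerivAt_id z).congr_of_eventuallyEq (by filter_upwards [hUz] using hgf)
    exact h1.unique h2
  have hiter : ∀ h : CSpace n → CSpace n, DifferentiableOn ℂ h U → MapsTo h U U →
      ∀ k, DifferentiableOn ℂ h^[k] U := fun h hd hm k => hd.iterate hm k
  have hBk : ∀ k, ‖B ^ k‖ ≤ 2 * M / (3 * R) := fun k => by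
    rw [← (hgz'.iterate hgz k).fderiv]
    exact norm_fderiv_le_of_norm_le (by positivity) ((hiter g hgd hgb.mapsTo k).mono hball)
      fun x hx => hM _ (hgb.mapsTo.iterate k (hball hx))
  let ψ : ℕ → CSpace n → CSpace n := fun k x => (B ^ k) (f^[k] x)
  have hψC : ∀ k, ∀ x ∈ U, ‖ψ k x‖ ≤ C := fun k x hx =>
    (B ^ k).le_of_opNorm_le_of_le (hBk k) (hM _ (hfb.mapsTo.iterate k hx))
  have hψA : ∀ k, ∀ x ∈ U, ψ k (f x) = A (ψ (k + 1) x) := fun k x _ => by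
    have : B ^ k = A * B ^ (k + 1) := by rw [pow_succ', ← mul_assoc, hAB, one_mul]
    simp only [ψ, Function.iterate_succ_apply]
    rw [this]
    rfl
  have hψL : ∀ k, ApproximatesLinearOn (ψ k) (ContinuousLinearMap.id ℂ _) (ball z δ) (1 / 2) := by
    intro k
    refine approximatesLinearOn_of_norm_le hR
      ((B ^ k).differentiable.comp_differentiableOn ((hiter f hfd hfb.mapsTo k).mono hball))
      (fun x hx => hψC k x (hball hx)) ?_ hδR hδC
    have hBAk : B ^ k * A ^ k = 1 := by
      rw [← Commute.mul_pow (show Commute B A from hBA.trans hAB.symm), hBA, one_pow]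
    have h : HasFDerivAt (ψ k) (B ^ k * A ^ k) z :=
      (B ^ k).hasFDerivAt.comp z (hfz.iterate hz k)
    rwa [hBAk] at h
  have hδU : ball z δ ⊆ U := (ball_subset_ball (by linarith)).trans hball
  obtain ⟨φ, hφ, hφL⟩ :=
    exists_intertwining_approximatesLinearOn hfb.mapsTo hψC hψA hδU hψL
  refine (eq_of_isolated_fixedPoint_of_intertwining hδ hfz.continuousAt hz hw hwz
    (fun x hx => hφ x (hδU hx)) hφL ?_).symm
  obtain ⟨ε, hε, hiso⟩ := hdisc z ⟨hzU, hz⟩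
  filter_upwards [ball_mem_nhds z hε, hUz] with x hxε hxU hx
  by_contra hne
  exact absurd (hiso x ⟨hxU, hx⟩ hne) (not_le.2 hxε)
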